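/- arXiv:1805.06720 — 6 statements merged into one kernel-verified Lean document; each statement's English description precedes it below -/
import Mathlib

section
/- For any Orlicz function Φ and any lattice norm p on ℝ² with p((1,0)) = 1, the functional ‖·‖_{Φ,p} is a norm on L^Φ(μ); that is: (a) ‖x‖_{Φ,p} = 0 if and only if x = 0 μ-a.e.; (b) ‖λx‖_{Φ,p} = |λ|·‖x‖_{Φ,p} for every λ ∈ ℝ and x ∈ L^Φ(μ); (c) ‖x + y‖_{Φ,p} ≤ ‖x‖_{Φ,p} + ‖y‖_{Φ,p} for all x, y ∈ L^Φ(μ). -/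
open MeasureTheory Filter

noncomputable section

/-- The Orlicz modular `I_Φ(x) = ∫ Φ(x t) dμ` (valued in `[0,∞]`). -/
def Iphi {Ω : Type*} [MeasurableSpace Ω] (μ : Measure Ω) (Φ : ℝ → ℝ) (x : Ω → ℝ) : ENNReal :=
  ∫⁻ t, ENNReal.ofReal (Φ (x t)) ∂μ

/-- One term `(1/k)·p((1, I_Φ(kx)))` of the defining infimum; value `∞` if `I_Φ(kx) = ∞`. -/
def aTerm {Ω : Type*} [MeasurableSpace Ω] (μ : Measure Ω) (Φ : ℝ → ℝ) (p : ℝ × ℝ → ℝ)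
    (x : Ω → ℝ) (k : ℝ) : ENNReal :=
  if Iphi μ Φ (fun t => k * x t) = ⊤ then ⊤
  else ENNReal.ofReal ((1 / k) * p (1, (Iphi μ Φ (fun t => k * x t)).toReal))

/-- The norm `‖x‖_{Φ,p} = inf_{k>0} (1/k)·p((1, I_Φ(kx)))`. -/
def aNorm {Ω : Type*} [MeasurableSpace Ω] (μ : Measure Ω) (Φ : ℝ → ℝ) (p : ℝ × ℝ → ℝ)
    (x : Ω → ℝ) : ENNReal :=
  ⨅ (k : ℝ) (_ : 0 < k), aTerm μ Φ p x k

/-- `Φ` is an Orlicz function: convex, even, vanishing at `0`, nonnegative, not identically `0`. -/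
def IsOrlicz (Φ : ℝ → ℝ) : Prop :=
  ConvexOn ℝ Set.univ Φ ∧ (∀ u, Φ (-u) = Φ u) ∧ Φ 0 = 0 ∧ (∀ u, 0 ≤ Φ u) ∧ ∃ u, Φ u ≠ 0

/-- `p` is a lattice norm on `ℝ²`: a norm which is monotone with respect to the
coordinatewise order on absolute values. -/
def IsLatticeNorm (p : ℝ × ℝ → ℝ) : Prop :=
  (∀ a b : ℝ × ℝ, p (a + b) ≤ p a + p b) ∧ (∀ (c : ℝ) (a : ℝ × ℝ), p (c • a) = |c| * p a) ∧
  (∀ a : ℝ × ℝ, p a = 0 → a = 0) ∧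
  (∀ a b : ℝ × ℝ, |a.1| ≤ |b.1| → |a.2| ≤ |b.2| → p a ≤ p b)

/-- `p` is strictly monotone: `0 ≤ a ≤ b` coordinatewise and `a ≠ b` imply `p a < p b`. -/
def StrictMonoNorm (p : ℝ × ℝ → ℝ) : Prop :=
  ∀ a b : ℝ × ℝ, 0 ≤ a.1 → 0 ≤ a.2 → a.1 ≤ b.1 → a.2 ≤ b.2 → a ≠ b → p a < p b

/-- Membership in the Orlicz space `L^Φ(μ)`. -/
def MemLphi {Ω : Type*} [MeasurableSpace Ω] (μ : Measure Ω) (Φ : ℝ → ℝ) (x : Ω → ℝ) : Prop :=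
  Measurable x ∧ ∃ l : ℝ, 0 < l ∧ Iphi μ Φ (fun t => l * x t) ≠ ⊤

/-- Membership in the space `E^Φ(μ)` of order continuous elements. -/
def MemEphi {Ω : Type*} [MeasurableSpace Ω] (μ : Measure Ω) (Φ : ℝ → ℝ) (x : Ω → ℝ) : Prop :=
  Measurable x ∧ ∀ l : ℝ, 0 < l → Iphi μ Φ (fun t => l * x t) ≠ ⊤

/-- `a(Φ) = sup{u ≥ 0 : Φ(u) = 0}`. -/
def aPhi (Φ : ℝ → ℝ) : ℝ := sSup {u : ℝ | 0 ≤ u ∧ Φ u = 0}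

/-- `K(x) = {k > 0 : ‖x‖_{Φ,p} = (1/k)·p((1, I_Φ(kx)))}`. -/
def Kset {Ω : Type*} [MeasurableSpace Ω] (μ : Measure Ω) (Φ : ℝ → ℝ) (p : ℝ × ℝ → ℝ)
    (x : Ω → ℝ) : Set ℝ :=
  {k : ℝ | 0 < k ∧ aNorm μ Φ p x = aTerm μ Φ p x k}

/-- Condition `Δ₂(ℝ₊)`: `Φ(2u) ≤ K·Φ(u)` for all `u ≥ 0`. -/
def Delta2 (Φ : ℝ → ℝ) : Prop := ∃ K : ℝ, 0 < K ∧ ∀ u : ℝ, 0 ≤ u → Φ (2 * u) ≤ K * Φ u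

/-- A non-atomic measure: every set of positive measure has a measurable subset of
strictly smaller positive measure. -/
def NonAtomic {Ω : Type*} [MeasurableSpace Ω] (μ : Measure Ω) : Prop :=
  ∀ A : Set Ω, MeasurableSet A → 0 < μ A →
    ∃ B ⊆ A, MeasurableSet B ∧ 0 < μ B ∧ μ B < μ A

/-- The modulus of monotonicity of `(ℝ², p)`:
`δ_{m,p}(ε) = inf{1 − p(b − a) : 0 ≤ a ≤ b coordinatewise, p a ≥ ε, p b = 1}`. -/
def deltaM (p : ℝ × ℝ → ℝ) (ε : ℝ) : ℝ :=
  sInf {d : ℝ | ∃ a b : ℝ × ℝ, 0 ≤ a.1 ∧ 0 ≤ a.2 ∧ a.1 ≤ b.1 ∧ a.2 ≤ b.2 ∧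
    ε ≤ p a ∧ p b = 1 ∧ d = 1 - p (b - a)}

section Modular

variable {Ω : Type*} [MeasurableSpace Ω] {μ : Measure Ω} {Φ : ℝ → ℝ} {p : ℝ × ℝ → ℝ}

lemma IsOrlicz.continuous (hΦ : IsOrlicz Φ) : Continuous Φ :=
  continuousOn_univ.1 (hΦ.1.continuousOn isOpen_univ)

lemma IsOrlicz.map_abs (hΦ : IsOrlicz Φ) (u : ℝ) : Φ |u| = Φ u := by
  rcases abs_choice u with h | h <;> rw [h]
  exact hΦ.2.1 u

lemma IsOrlicz.map_mul_le (hΦ : IsOrlicz Φ) {c : ℝ} (h0 : 0 ≤ c) (h1 : c ≤ 1) (u : ℝ) :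
    Φ (c * u) ≤ c * Φ u := by
  have h := hΦ.1.2 (Set.mem_univ u) (Set.mem_univ 0) h0 (sub_nonneg.2 h1) (by ring)
  simpa [hΦ.2.2.1] using h

lemma IsOrlicz.eq_zero_of_forall_nat (hΦ : IsOrlicz Φ) {v : ℝ}
    (h : ∀ n : ℕ, Φ ((n + 1 : ℝ) * v) = 0) : v = 0 := by
  by_contra hv
  obtain ⟨u, hu⟩ := hΦ.2.2.2.2
  have hv' : 0 < |v| := abs_pos.2 hv
  obtain ⟨n, hn⟩ := exists_nat_ge (|u| / |v|)
  have hn' : |u| ≤ (n + 1 : ℝ) * |v| := by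
    rw [div_le_iff₀ hv'] at hn
    linarith
  have hpos : 0 < (n + 1 : ℝ) * |v| := by positivity
  have hle := hΦ.map_mul_le (c := |u| / ((n + 1 : ℝ) * |v|)) (by positivity)
    ((div_le_one hpos).2 hn') ((n + 1 : ℝ) * |v|)
  have hz : Φ ((n + 1 : ℝ) * |v|) = 0 := by
    rw [← h n, ← hΦ.map_abs ((n + 1 : ℝ) * v), abs_mul,
      abs_of_pos (by positivity : (0 : ℝ) < n + 1)]
  rw [div_mul_cancel₀ _ hpos.ne', hz, mul_zero, hΦ.map_abs] at hle
  exact hu (le_antisymm hle (hΦ.2.2.2.1 u))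

lemma IsOrlicz.Iphi_mul_eq_abs (hΦ : IsOrlicz Φ) (x : Ω → ℝ) (k : ℝ) :
    Iphi μ Φ (fun t => k * x t) = Iphi μ Φ (fun t => |k| * x t) := by
  unfold Iphi
  refine lintegral_congr fun t => ?_
  rw [← hΦ.map_abs (k * x t), ← hΦ.map_abs (|k| * x t), abs_mul, abs_mul, abs_abs]

lemma IsOrlicz.Iphi_eq_zero (hΦ : IsOrlicz Φ) {x : Ω → ℝ} (hx : x =ᵐ[μ] 0) :
    Iphi μ Φ x = 0 := by
  unfold Iphi
  refine (lintegral_congr_ae ?_).trans lintegral_zero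
  filter_upwards [hx] with t ht
  simp [ht, hΦ.2.2.1]

lemma IsOrlicz.Iphi_mul_le (hΦ : IsOrlicz Φ) (x : Ω → ℝ) {j k : ℝ} (hj : 0 < j) (hjk : j ≤ k) :
    Iphi μ Φ (fun t => j * x t) ≤ ENNReal.ofReal (j / k) * Iphi μ Φ (fun t => k * x t) := by
  have hk : 0 < k := hj.trans_le hjk
  unfold Iphi
  rw [← lintegral_const_mul' _ _ ENNReal.ofReal_ne_top]
  refine lintegral_mono fun t => ?_
  rw [← ENNReal.ofReal_mul (by positivity)]
  refine ENNReal.ofReal_le_ofReal ?_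
  have h := hΦ.map_mul_le (c := j / k) (by positivity) ((div_le_one hk).2 hjk) (k * x t)
  rwa [← mul_assoc, div_mul_cancel₀ _ hk.ne'] at h

lemma IsOrlicz.Iphi_convex (hΦ : IsOrlicz Φ) {x : Ω → ℝ} (hx : Measurable x) (y : Ω → ℝ)
    {a b : ℝ} (ha : 0 ≤ a) (hb : 0 ≤ b) (hab : a + b = 1) :
    Iphi μ Φ (fun t => a * x t + b * y t) ≤
      ENNReal.ofReal a * Iphi μ Φ x + ENNReal.ofReal b * Iphi μ Φ y := by
  have hm : Measurable fun t => ENNReal.ofReal a * ENNReal.ofReal (Φ (x t)) :=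
    ((hΦ.continuous.measurable.comp hx).ennreal_ofReal).const_mul _
  unfold Iphi
  rw [← lintegral_const_mul' _ _ ENNReal.ofReal_ne_top,
    ← lintegral_const_mul' _ _ ENNReal.ofReal_ne_top, ← lintegral_add_left hm]
  refine lintegral_mono fun t => ?_
  have hx0 := hΦ.2.2.2.1 (x t)
  have hy0 := hΦ.2.2.2.1 (y t)
  rw [← ENNReal.ofReal_mul ha, ← ENNReal.ofReal_mul hb,
    ← ENNReal.ofReal_add (by positivity) (by positivity)]
  exact ENNReal.ofReal_le_ofReal (hΦ.1.2 (Set.mem_univ _) (Set.mem_univ _) ha hb hab)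

lemma IsLatticeNorm.nonneg (hp : IsLatticeNorm p) (a : ℝ × ℝ) : 0 ≤ p a := by
  have h0 : p 0 = 0 := by simpa using hp.2.1 0 0
  exact h0 ▸ hp.2.2.2 0 a (by simp) (by simp)

lemma IsLatticeNorm.one_le (hp : IsLatticeNorm p) (h10 : p (1, 0) = 1) (s : ℝ) :
    1 ≤ p (1, s) :=
  h10.ge.trans (hp.2.2.2 (1, 0) (1, s) le_rfl (by simp))

lemma IsLatticeNorm.snd_pos (hp : IsLatticeNorm p) : 0 < p (0, 1) :=
  (hp.nonneg _).lt_of_ne fun h => by simpa using hp.2.2.1 _ h.symm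

lemma IsLatticeNorm.mul_snd_le (hp : IsLatticeNorm p) {s : ℝ} (hs : 0 ≤ s) :
    s * p (0, 1) ≤ p (1, s) := by
  have h1 := hp.2.1 s (0, 1)
  have h2 := hp.2.2.2 (s • (0, 1)) (1, s) (by simp) (by simp)
  rwa [h1, abs_of_nonneg hs] at h2

lemma IsOrlicz.aNorm_eq_zero (hΦ : IsOrlicz Φ) (h10 : p (1, 0) = 1) {x : Ω → ℝ}
    (hx : x =ᵐ[μ] 0) : aNorm μ Φ p x = 0 := by
  refine le_antisymm (ENNReal.le_of_forall_pos_le_add fun ε hε _ => ?_) zero_le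
  have hI : Iphi μ Φ (fun t => (ε : ℝ)⁻¹ * x t) = 0 := hΦ.Iphi_eq_zero <| by
    filter_upwards [hx] with t ht
    simp [ht]
  refine (iInf₂_le ((ε : ℝ)⁻¹) (by positivity)).trans ?_
  simp [aTerm, hI, h10]

lemma aNorm_eq_zero_imp_Iphi_eq_zero (hΦ : IsOrlicz Φ) (hp : IsLatticeNorm p)
    (h10 : p (1, 0) = 1) {x : Ω → ℝ} (hx : aNorm μ Φ p x = 0) {j : ℝ} (hj : 0 < j) :
    Iphi μ Φ (fun t => j * x t) = 0 := by
  have hq := hp.snd_pos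
  refine le_antisymm (ENNReal.le_of_forall_pos_le_add fun ε hε _ => ?_) zero_le
  have hδ : 0 < min (1 / j) (ε * p (0, 1) / j) := by positivity
  have hlt : aNorm μ Φ p x < ENNReal.ofReal (min (1 / j) (ε * p (0, 1) / j)) := by
    simpa [hx] using hδ
  obtain ⟨k, hk⟩ := iInf_lt_iff.1 hlt
  obtain ⟨hk0, hk⟩ := iInf_lt_iff.1 hk
  unfold aTerm at hk
  split_ifs at hk with htop
  · simp at hk
  rw [ENNReal.ofReal_lt_ofReal_iff hδ, lt_min_iff] at hk
  have h1 := hp.one_le h10 (Iphi μ Φ (fun t => k * x t)).toReal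
  have h2 := hp.mul_snd_le (ENNReal.toReal_nonneg (a := Iphi μ Φ (fun t => k * x t)))
  have hjk : j ≤ k := by
    refine le_of_one_div_le_one_div hk0 ((le_mul_of_one_le_right (by positivity) h1).trans hk.1.le)
  refine (hΦ.Iphi_mul_le x hj hjk).trans ?_
  rw [zero_add, ← ENNReal.ofReal_toReal htop, ← ENNReal.ofReal_mul (by positivity),
    ← ENNReal.ofReal_coe_nnreal]
  refine ENNReal.ofReal_le_ofReal ?_
  have h3 := hk.2
  rw [one_div, inv_mul_lt_iff₀ hk0] at h3
  refine le_of_mul_le_mul_right ?_ hq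
  calc j / k * (Iphi μ Φ (fun t => k * x t)).toReal * p (0, 1)
      = j / k * ((Iphi μ Φ (fun t => k * x t)).toReal * p (0, 1)) := by ring
    _ ≤ j / k * (k * (ε * p (0, 1) / j)) :=
      mul_le_mul_of_nonneg_left (h2.trans h3.le) (by positivity)
    _ = ε * p (0, 1) := by field_simp

lemma ae_eq_zero_of_aNorm_eq_zero (hΦ : IsOrlicz Φ) (hp : IsLatticeNorm p)
    (h10 : p (1, 0) = 1) {x : Ω → ℝ} (hxm : Measurable x) (hx : aNorm μ Φ p x = 0) :
    x =ᵐ[μ] 0 := by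
  have hae : ∀ n : ℕ, ∀ᵐ t ∂μ, Φ ((n + 1 : ℝ) * x t) = 0 := fun n => by
    have h := aNorm_eq_zero_imp_Iphi_eq_zero hΦ hp h10 hx (j := n + 1) (by positivity)
    have hm : Measurable fun t => ENNReal.ofReal (Φ ((n + 1 : ℝ) * x t)) :=
      (hΦ.continuous.measurable.comp (hxm.const_mul _)).ennreal_ofReal
    filter_upwards [(lintegral_eq_zero_iff hm).1 h] with t ht
    exact le_antisymm (ENNReal.ofReal_eq_zero.1 ht) (hΦ.2.2.2.1 _)
  filter_upwards [ae_all_iff.2 hae] with t ht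
  exact hΦ.eq_zero_of_forall_nat ht

lemma IsOrlicz.aTerm_const_mul (hΦ : IsOrlicz Φ) (x : Ω → ℝ) {c k : ℝ} (hc : c ≠ 0)
    (hk : 0 < k) :
    aTerm μ Φ p (fun t => c * x t) k = ENNReal.ofReal |c| * aTerm μ Φ p x (|c| * k) := by
  have hc' : 0 < |c| := abs_pos.2 hc
  have hI : Iphi μ Φ (fun t => k * (c * x t)) = Iphi μ Φ (fun t => |c| * k * x t) := by
    simp_rw [← mul_assoc]
    rw [hΦ.Iphi_mul_eq_abs x (k * c), abs_mul, abs_of_pos hk, mul_comm k]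
  unfold aTerm
  rw [hI]
  split_ifs
  · rw [ENNReal.mul_top (by simpa using hc)]
  · rw [← ENNReal.ofReal_mul hc'.le]
    congr 1
    field_simp

lemma IsOrlicz.aNorm_const_mul (hΦ : IsOrlicz Φ) (h10 : p (1, 0) = 1) (x : Ω → ℝ) (c : ℝ) :
    aNorm μ Φ p (fun t => c * x t) = ENNReal.ofReal |c| * aNorm μ Φ p x := by
  rcases eq_or_ne c 0 with rfl | hc
  · simpa using hΦ.aNorm_eq_zero h10 (μ := μ) (ae_eq_refl (fun _ : Ω => (0 : ℝ)))
  have hc' : 0 < |c| := abs_pos.2 hc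
  have hc0 : ENNReal.ofReal |c| ≠ 0 := by simpa using hc
  unfold aNorm
  simp_rw [ENNReal.mul_iInf_of_ne hc0 ENNReal.ofReal_ne_top]
  refine le_antisymm (le_iInf₂ fun k hk => ?_) (le_iInf₂ fun k hk => ?_)
  · refine (iInf₂_le (k / |c|) (by positivity)).trans_eq ?_
    rw [hΦ.aTerm_const_mul x hc (by positivity), mul_div_cancel₀ _ hc'.ne']
  · rw [hΦ.aTerm_const_mul x hc hk]
    exact iInf₂_le (|c| * k) (by positivity)

lemma aTerm_add_le (hΦ : IsOrlicz Φ) (hp : IsLatticeNorm p) {x : Ω → ℝ} (hx : Measurable x)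
    (y : Ω → ℝ) {k l : ℝ} (hk : 0 < k) (hl : 0 < l) :
    aTerm μ Φ p (fun t => x t + y t) (k * l / (k + l)) ≤
      aTerm μ Φ p x k + aTerm μ Φ p y l := by
  have hkl : 0 < k + l := add_pos hk hl
  have hI := hΦ.Iphi_convex (μ := μ) (hx.const_mul k) (fun t => l * y t)
    (a := l / (k + l)) (b := k / (k + l)) (by positivity) (by positivity) (by field_simp; ring)
  have heq : (fun t => l / (k + l) * (k * x t) + k / (k + l) * (l * y t)) =
      fun t => k * l / (k + l) * (x t + y t) := by
    funext t
    field_simp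
  rw [heq] at hI
  unfold aTerm
  by_cases hX : Iphi μ Φ (fun t => k * x t) = ⊤
  · simp [hX]
  by_cases hY : Iphi μ Φ (fun t => l * y t) = ⊤
  · simp [hY]
  have hS : ENNReal.ofReal (l / (k + l)) * Iphi μ Φ (fun t => k * x t) +
      ENNReal.ofReal (k / (k + l)) * Iphi μ Φ (fun t => l * y t) ≠ ⊤ := by finiteness
  rw [if_neg hX, if_neg hY, if_neg (ne_top_of_le_ne_top hS hI),
    ← ENNReal.ofReal_add (mul_nonneg (by positivity) (hp.nonneg _))
      (mul_nonneg (by positivity) (hp.nonneg _))]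
  refine ENNReal.ofReal_le_ofReal ?_
  have hI' := ENNReal.toReal_mono hS hI
  rw [ENNReal.toReal_add (by finiteness) (by finiteness), ENNReal.toReal_mul, ENNReal.toReal_mul,
    ENNReal.toReal_ofReal (by positivity), ENNReal.toReal_ofReal (by positivity)] at hI'
  set X := (Iphi μ Φ (fun t => k * x t)).toReal
  set Y := (Iphi μ Φ (fun t => l * y t)).toReal
  have hsum : l / (k + l) + k / (k + l) = 1 := by field_simp; ring
  have hmono := hp.2.2.2
    (1, (Iphi μ Φ (fun t => k * l / (k + l) * (x t + y t))).toReal)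
    ((l / (k + l)) • (1, X) + (k / (k + l)) • (1, Y)) (by simp [hsum])
    (by
      simp only [Prod.snd_add, Prod.smul_snd, smul_eq_mul]
      exact abs_le_abs_of_nonneg ENNReal.toReal_nonneg hI')
  have hadd := hp.1 ((l / (k + l)) • (1, X)) ((k / (k + l)) • (1, Y))
  rw [hp.2.1, hp.2.1, abs_of_pos (by positivity), abs_of_pos (by positivity)] at hadd
  calc 1 / (k * l / (k + l)) * p (1, (Iphi μ Φ (fun t => k * l / (k + l) * (x t + y t))).toReal)
      ≤ 1 / (k * l / (k + l)) * (l / (k + l) * p (1, X) + k / (k + l) * p (1, Y)) := by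
        gcongr
        exact hmono.trans hadd
    _ = 1 / k * p (1, X) + 1 / l * p (1, Y) := by field_simp

lemma aNorm_add_le (hΦ : IsOrlicz Φ) (hp : IsLatticeNorm p) {x : Ω → ℝ} (hx : Measurable x)
    (y : Ω → ℝ) :
    aNorm μ Φ p (fun t => x t + y t) ≤ aNorm μ Φ p x + aNorm μ Φ p y := by
  conv_rhs => unfold aNorm
  simp_rw [ENNReal.iInf_add, ENNReal.add_iInf]
  exact le_iInf₂ fun k hk => le_iInf₂ fun l hl =>
    (iInf₂_le (k * l / (k + l)) (by positivity)).trans (aTerm_add_le hΦ hp hx y hk hl)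

end Modular

/-- For any Orlicz function `Φ` and any lattice norm `p` on `ℝ²` with `p (1,0) = 1`, the
functional `‖·‖_{Φ,p}` is a norm on `L^Φ(μ)`: it vanishes exactly on the (a.e.) zero function,
it is absolutely homogeneous, and it satisfies the triangle inequality. -/
theorem stmt1 {Ω : Type*} [MeasurableSpace Ω] (μ : Measure Ω) [SigmaFinite μ]
    (Φ : ℝ → ℝ) (hΦ : IsOrlicz Φ)
    (p : ℝ × ℝ → ℝ) (hp : IsLatticeNorm p) (h10 : p (1, 0) = 1) :
    (∀ x : Ω → ℝ, MemLphi μ Φ x → (aNorm μ Φ p x = 0 ↔ x =ᵐ[μ] 0)) ∧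
    (∀ (x : Ω → ℝ) (c : ℝ), MemLphi μ Φ x →
      aNorm μ Φ p (fun t => c * x t) = ENNReal.ofReal |c| * aNorm μ Φ p x) ∧
    (∀ x y : Ω → ℝ, MemLphi μ Φ x → MemLphi μ Φ y →
      aNorm μ Φ p (fun t => x t + y t) ≤ aNorm μ Φ p x + aNorm μ Φ p y) := by
  exact ⟨fun _ hx => ⟨ae_eq_zero_of_aNorm_eq_zero hΦ hp h10 hx.1, hΦ.aNorm_eq_zero h10⟩,
    fun x c _ => hΦ.aNorm_const_mul h10 x c, fun _ y hx _ => aNorm_add_le hΦ hp hx.1 y⟩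
end
end

section
/- Let Φ be an Orlicz function and p a lattice norm on ℝ² with p((1,0)) = p((0,1)) = 1. If x ∈ L^Φ(μ) satisfies I_Φ(λx) = +∞ for every λ > 1, then 1 ≤ ‖x‖_{Φ,p} ≤ 1 + I_Φ(x). -/
open MeasureTheory Filter

noncomputable section

/-- If `Φ` is an Orlicz function, `p` a lattice norm on `ℝ²` with `p (1,0) = p (0,1) = 1`,
and `x ∈ L^Φ(μ)` satisfies `I_Φ(λx) = ∞` for every `λ > 1`, then
`1 ≤ ‖x‖_{Φ,p} ≤ 1 + I_Φ(x)`. -/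
theorem stmt3 {Ω : Type*} [MeasurableSpace Ω] (μ : Measure Ω) [SigmaFinite μ]
    (Φ : ℝ → ℝ) (hΦ : IsOrlicz Φ)
    (p : ℝ × ℝ → ℝ) (hp : IsLatticeNorm p) (h10 : p (1, 0) = 1) (h01 : p (0, 1) = 1)
    (x : Ω → ℝ) (hx : MemLphi μ Φ x)
    (hinf : ∀ l : ℝ, 1 < l → Iphi μ Φ (fun t => l * x t) = ⊤) :
    1 ≤ aNorm μ Φ p x ∧ aNorm μ Φ p x ≤ 1 + Iphi μ Φ x := by
  obtain ⟨hadd, hsmul, -, hmono⟩ := hp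
  constructor
  · refine le_iInf₂ fun k hk => ?_
    unfold aTerm
    split_ifs with h
    · exact le_top
    · have hk1 : k ≤ 1 := not_lt.mp fun hlt => h (hinf k hlt)
      have h1 : 1 ≤ p (1, (Iphi μ Φ (fun t => k * x t)).toReal) :=
        h10.ge.trans (hmono _ _ le_rfl (by simp))
      rw [ENNReal.one_le_ofReal]
      exact one_le_mul_of_one_le_of_one_le ((one_le_div hk).2 hk1) h1
  · refine (iInf₂_le 1 one_pos).trans ?_
    simp only [aTerm, one_mul, div_one]
    split_ifs with h
    · simp [h]
    · set r := (Iphi μ Φ x).toReal with hr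
      have hr0 : 0 ≤ r := ENNReal.toReal_nonneg
      have hp1 : p (1, r) ≤ 1 + r := by
        have ha := hadd (1, 0) (r • (0, 1))
        rw [hsmul, h10, h01, abs_of_nonneg hr0] at ha
        simpa using ha
      calc ENNReal.ofReal (p (1, r)) ≤ ENNReal.ofReal (1 + r) := ENNReal.ofReal_le_ofReal hp1
        _ = 1 + Iphi μ Φ x := by
          rw [ENNReal.ofReal_add zero_le_one hr0, ENNReal.ofReal_one, hr, ENNReal.ofReal_toReal h]
end
end

section
/- Let p be a lattice norm on ℝ² with p((1,0)) = p((0,1)) = 1, and let Φ be an Orlicz function with a(Φ) > 0. If the measure space admits a sequence (A_n)_{n≥1} of pairwise disjoint measurable sets with μ(A_n) = ∞ for every n (as holds both for an infinite non-atomic σ-finite measure and for the counting measure on ℕ), then (L^Φ(μ), ‖·‖_{Φ,p}) contains a linearly order isometric copy of ℓ^∞: there exists a linear operator P : ℓ^∞ → L^Φ(μ) such that P z ≥ 0 μ-a.e. whenever z ≥ 0, and ‖P z‖_{Φ,p} = ‖z‖_∞ for every z ∈ ℓ^∞. -/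
open MeasureTheory Filter

noncomputable section

namespace IsOrlicz

variable {Φ : ℝ → ℝ}

theorem eq_zero_of_abs_le (hΦ : IsOrlicz Φ) {u s : ℝ} (hs : Φ s = 0) (h : |u| ≤ s) :
    Φ u = 0 := by
  obtain ⟨hc, hev, -, hnn, -⟩ := hΦ
  have h1 := hc.le_max_of_mem_Icc (Set.mem_univ (-s)) (Set.mem_univ s) (abs_le.mp h)
  rw [hev, hs, max_self] at h1
  exact le_antisymm h1 (hnn u)

theorem bddAbove_zeros (hΦ : IsOrlicz Φ) : BddAbove {u : ℝ | 0 ≤ u ∧ Φ u = 0} := by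
  obtain ⟨v, hv⟩ := hΦ.2.2.2.2
  refine ⟨|v|, fun s hs => ?_⟩
  by_contra! h
  exact hv (hΦ.eq_zero_of_abs_le hs.2 h.le)

theorem map_aPhi (hΦ : IsOrlicz Φ) : Φ (aPhi Φ) = 0 := by
  have hcont : Continuous Φ :=
    continuousOn_univ.mp (hΦ.1.continuousOn isOpen_univ)
  have hcl : IsClosed {u : ℝ | 0 ≤ u ∧ Φ u = 0} :=
    (isClosed_le continuous_const continuous_id).inter
      (isClosed_eq hcont continuous_const)
  exact (hcl.csSup_mem ⟨0, le_rfl, hΦ.2.2.1⟩ hΦ.bddAbove_zeros).2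

theorem eq_zero_iff (hΦ : IsOrlicz Φ) (u : ℝ) : Φ u = 0 ↔ |u| ≤ aPhi Φ := by
  refine ⟨fun h => le_csSup hΦ.bddAbove_zeros ⟨abs_nonneg u, ?_⟩,
    hΦ.eq_zero_of_abs_le hΦ.map_aPhi⟩
  rcases abs_choice u with h' | h' <;> rw [h']
  · exact h
  · rw [hΦ.2.1, h]

end IsOrlicz

/-- `ENNReal.ofReal r` is the infimum of `1 / k` over those `k > 0` with `k * r ≤ 1`. -/
theorem iInf_ofReal_one_div {r : ℝ} (hr : 0 ≤ r) :
    ⨅ (k : ℝ) (_ : 0 < k), (if k * r ≤ 1 then ENNReal.ofReal (1 / k) else ⊤)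
      = ENNReal.ofReal r := by
  apply le_antisymm
  · refine ENNReal.le_of_forall_pos_le_add fun ε hε _ => ?_
    have hpos : 0 < r + ε := add_pos_of_nonneg_of_pos hr (NNReal.coe_pos.mpr hε)
    refine (iInf₂_le (r + ε)⁻¹ (inv_pos.mpr hpos)).trans ?_
    have hle : (r + ε)⁻¹ * r ≤ 1 := by
      rw [inv_mul_le_iff₀ hpos]
      linarith [NNReal.coe_nonneg ε]
    rw [if_pos hle, one_div, inv_inv, ENNReal.ofReal_add hr ε.coe_nonneg,
      ENNReal.ofReal_coe_nnreal]
  · refine le_iInf₂ fun k hk => ?_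
    split_ifs with h
    · exact ENNReal.ofReal_le_ofReal ((le_div_iff₀ hk).mpr (by linarith))
    · exact le_top

open Classical in
/-- The index shifted by one of a member of `A` containing `t`, and `0` if there is none. -/
def coverIndex {Ω : Type*} (A : ℕ → Set Ω) (t : Ω) : ℕ :=
  if h : ∃ n, t ∈ A n then h.choose + 1 else 0

theorem coverIndex_eq_succ_iff {Ω : Type*} {A : ℕ → Set Ω}
    (hA : Pairwise (Function.onFun Disjoint A)) (t : Ω) (n : ℕ) :
    coverIndex A t = n + 1 ↔ t ∈ A n := by
  unfold coverIndex
  split_ifs with h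
  · rw [Nat.add_right_cancel_iff]
    refine ⟨fun e => e ▸ h.choose_spec, fun ht => ?_⟩
    by_contra hne
    exact Set.disjoint_left.mp (hA hne) h.choose_spec ht
  · exact ⟨fun e => e.elim, fun ht => absurd ⟨n, ht⟩ h⟩

theorem measurable_coverIndex {Ω : Type*} [MeasurableSpace Ω] {A : ℕ → Set Ω}
    (hA : Pairwise (Function.onFun Disjoint A)) (hm : ∀ n, MeasurableSet (A n)) :
    Measurable (coverIndex A) := by
  have hsucc (n : ℕ) : coverIndex A ⁻¹' {n + 1} = A n :=
    Set.ext fun t => coverIndex_eq_succ_iff hA t n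
  have hzero : coverIndex A ⁻¹' {0} = (⋃ n, A n)ᶜ := by
    ext t
    simp only [Set.mem_preimage, Set.mem_singleton_iff, Set.mem_compl_iff, Set.mem_iUnion,
      ← coverIndex_eq_succ_iff hA]
    exact ⟨fun h ⟨n, hn⟩ => by omega, fun h => by
      by_contra h0
      exact h ⟨_, (Nat.succ_pred_eq_of_ne_zero h0).symm⟩⟩
  refine measurable_to_countable' fun n => ?_
  cases n with
  | zero => exact hzero ▸ (MeasurableSet.iUnion hm).compl
  | succ n => exact (hsucc n).symm ▸ hm n

/-- The linear map sending a bounded sequence `z` to the function equal to `c * z n` on `A n`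
and to `0` off the union of the `A n`. -/
def stepMap {Ω : Type*} (A : ℕ → Set Ω) (c : ℝ) :
    lp (fun _ : ℕ => ℝ) ⊤ →ₗ[ℝ] (Ω → ℝ) where
  toFun z t := c * Nat.casesOn (motive := fun _ => ℝ) (coverIndex A t) 0 (fun n => z n)
  map_add' z w := by
    funext t
    cases h : coverIndex A t <;> simp [h, mul_add]
  map_smul' r z := by
    funext t
    cases h : coverIndex A t <;> simp [h, mul_left_comm]

theorem measurable_stepMap {Ω : Type*} [MeasurableSpace Ω] {A : ℕ → Set Ω}
    (hA : Pairwise (Function.onFun Disjoint A)) (hm : ∀ n, MeasurableSet (A n)) (c : ℝ)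
    (z : lp (fun _ : ℕ => ℝ) ⊤) : Measurable (stepMap A c z) :=
  (measurable_from_nat (f := fun m =>
    c * Nat.casesOn (motive := fun _ => ℝ) m 0 (fun n => z n))).comp
    (measurable_coverIndex hA hm)

theorem stepMap_of_mem {Ω : Type*} {A : ℕ → Set Ω}
    (hA : Pairwise (Function.onFun Disjoint A)) (c : ℝ) (z : lp (fun _ : ℕ => ℝ) ⊤)
    {t : Ω} {n : ℕ} (ht : t ∈ A n) : stepMap A c z t = c * z n := by
  simp [stepMap, (coverIndex_eq_succ_iff hA t n).mpr ht]

theorem stepMap_nonneg {Ω : Type*} (A : ℕ → Set Ω) {c : ℝ} (hc : 0 ≤ c)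
    {z : lp (fun _ : ℕ => ℝ) ⊤} (hz : ∀ n, 0 ≤ z n) (t : Ω) : 0 ≤ stepMap A c z t := by
  refine mul_nonneg hc ?_
  cases coverIndex A t
  · exact le_rfl
  · exact hz _

theorem abs_stepMap_le {Ω : Type*} (A : ℕ → Set Ω) {c : ℝ} (hc : 0 ≤ c)
    (z : lp (fun _ : ℕ => ℝ) ⊤) (t : Ω) : |stepMap A c z t| ≤ c * ‖z‖ := by
  change |c * _| ≤ _
  rw [abs_mul, abs_of_nonneg hc]
  refine mul_le_mul_of_nonneg_left ?_ hc
  cases coverIndex A t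
  · simp
  · exact lp.norm_apply_le_norm ENNReal.top_ne_zero z _

section Modular

variable {Ω : Type*} [MeasurableSpace Ω] (μ : Measure Ω) {Φ : ℝ → ℝ} {A : ℕ → Set Ω}

theorem Iphi_stepMap_eq_zero (hΦ : IsOrlicz Φ) (ha : 0 < aPhi Φ)
    (z : lp (fun _ : ℕ => ℝ) ⊤) {k : ℝ} (hk : 0 < k) (h : k * ‖z‖ ≤ 1) :
    Iphi μ Φ (fun t => k * stepMap A (aPhi Φ) z t) = 0 := by
  have h0 (t : Ω) : Φ (k * stepMap A (aPhi Φ) z t) = 0 := by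
    rw [hΦ.eq_zero_iff, abs_mul, abs_of_pos hk]
    calc k * |stepMap A (aPhi Φ) z t| ≤ k * (aPhi Φ * ‖z‖) :=
          mul_le_mul_of_nonneg_left (abs_stepMap_le A ha.le z t) hk.le
      _ = aPhi Φ * (k * ‖z‖) := by ring
      _ ≤ aPhi Φ := mul_le_of_le_one_right ha.le h
  simp [Iphi, h0]

theorem Iphi_stepMap_eq_top (hΦ : IsOrlicz Φ) (ha : 0 < aPhi Φ)
    (hAmeas : ∀ n, MeasurableSet (A n)) (hAdisj : Pairwise (Function.onFun Disjoint A))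
    (hAinf : ∀ n, μ (A n) = ⊤)
    (z : lp (fun _ : ℕ => ℝ) ⊤) {k : ℝ} (hk : 0 < k) (h : 1 < k * ‖z‖) :
    Iphi μ Φ (fun t => k * stepMap A (aPhi Φ) z t) = ⊤ := by
  obtain ⟨n, hn⟩ : ∃ n, 1 < k * |z n| := by
    by_contra! hcon
    have hle : ‖z‖ ≤ k⁻¹ := lp.norm_le_of_forall_le (inv_nonneg.mpr hk.le) fun n => by
      rw [Real.norm_eq_abs, ← one_div, le_div_iff₀ hk, mul_comm]
      exact hcon n
    have := mul_le_mul_of_nonneg_left hle hk.le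
    rw [mul_inv_cancel₀ hk.ne'] at this
    linarith
  have hne : Φ (k * (aPhi Φ * z n)) ≠ 0 := by
    rw [Ne, hΦ.eq_zero_iff, abs_mul, abs_mul, abs_of_pos hk, abs_of_pos ha, not_le]
    calc aPhi Φ < aPhi Φ * (k * |z n|) := lt_mul_of_one_lt_right ha hn
      _ = k * (aPhi Φ * |z n|) := by ring
  have hpos : 0 < Φ (k * (aPhi Φ * z n)) := (hΦ.2.2.2.1 _).lt_of_ne' hne
  refine top_le_iff.mp ?_
  calc ⊤ = ∫⁻ _ in A n, ENNReal.ofReal (Φ (k * (aPhi Φ * z n))) ∂μ := by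
        rw [setLIntegral_const, hAinf, ENNReal.mul_top (ENNReal.ofReal_pos.mpr hpos).ne']
    _ = ∫⁻ t in A n, ENNReal.ofReal (Φ (k * stepMap A (aPhi Φ) z t)) ∂μ :=
        setLIntegral_congr_fun (hAmeas n) fun t ht => by
          simp only [stepMap_of_mem hAdisj _ z ht]
    _ ≤ Iphi μ Φ (fun t => k * stepMap A (aPhi Φ) z t) := setLIntegral_le_lintegral _ _

end Modular

/-- If `p` is a lattice norm on `ℝ²` with `p (1,0) = p (0,1) = 1`, `Φ` is an Orlicz function
with `a(Φ) > 0`, and the measure space admits a sequence of pairwise disjoint measurable sets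
of infinite measure, then `(L^Φ(μ), ‖·‖_{Φ,p})` contains a linearly order isometric copy
of `ℓ^∞`. -/
theorem stmt5 {Ω : Type*} [MeasurableSpace Ω] (μ : Measure Ω) [SigmaFinite μ]
    (Φ : ℝ → ℝ) (hΦ : IsOrlicz Φ) (ha : 0 < aPhi Φ)
    (p : ℝ × ℝ → ℝ) (hp : IsLatticeNorm p) (h10 : p (1, 0) = 1) (h01 : p (0, 1) = 1)
    (A : ℕ → Set Ω) (hAmeas : ∀ n, MeasurableSet (A n))
    (hAdisj : Pairwise (Function.onFun Disjoint A)) (hAinf : ∀ n, μ (A n) = ⊤) :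
    ∃ P : lp (fun _ : ℕ => ℝ) ⊤ →ₗ[ℝ] (Ω → ℝ),
      (∀ z, MemLphi μ Φ (P z)) ∧
      (∀ z, (∀ n : ℕ, 0 ≤ z n) → ∀ᵐ t ∂μ, 0 ≤ P z t) ∧
      (∀ z, aNorm μ Φ p (P z) = ENNReal.ofReal ‖z‖) := by
  refine ⟨stepMap A (aPhi Φ), fun z => ⟨measurable_stepMap hAdisj hAmeas _ z, ?_⟩,
    fun z hz => Eventually.of_forall (stepMap_nonneg A ha.le hz), fun z => ?_⟩
  · have hpos : 0 < ‖z‖ + 1 := by positivity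
    refine ⟨(‖z‖ + 1)⁻¹, inv_pos.mpr hpos, ?_⟩
    rw [Iphi_stepMap_eq_zero μ hΦ ha z (inv_pos.mpr hpos)
      ((inv_mul_le_iff₀ hpos).mpr (by linarith))]
    exact ENNReal.zero_ne_top
  · rw [aNorm, ← iInf_ofReal_one_div (norm_nonneg z)]
    refine iInf_congr fun k => iInf_congr fun hk => ?_
    rw [aTerm]
    split_ifs with htop hle hle
    · rw [Iphi_stepMap_eq_zero μ hΦ ha z hk hle] at htop
      exact absurd htop ENNReal.zero_ne_top
    · rfl
    · rw [Iphi_stepMap_eq_zero μ hΦ ha z hk hle, ENNReal.toReal_zero, h10, mul_one]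
    · exact absurd (Iphi_stepMap_eq_top μ hΦ ha hAmeas hAdisj hAinf z hk (not_le.mp hle)) htop
end
end

section
/- Let Φ be a strictly convex Orlicz function, and consider the Orlicz (Amemiya) norm ‖x‖⁰_Φ = inf_{k>0} (1/k)·(1 + I_Φ(kx)) on L^Φ(μ). Assume that for every x ∈ L^Φ(μ) with x ≠ 0 there exists k ∈ (0,∞) with ‖x‖⁰_Φ = (1/k)·(1 + I_Φ(kx)). Then (L^Φ(μ), ‖·‖⁰_Φ) is strictly convex: for all x, y ∈ L^Φ(μ) with ‖x‖⁰_Φ = ‖y‖⁰_Φ = 1 and x ≠ y, one has ‖(x+y)/2‖⁰_Φ < 1. -/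
open MeasureTheory Filter

noncomputable section

/-- A convex function which is strictly convex at midpoints is strictly convex. -/
theorem strictConvexOn_of_midpoint {Φ : ℝ → ℝ} (hΦ : ConvexOn ℝ Set.univ Φ)
    (hsc : ∀ u v : ℝ, u ≠ v → Φ ((u + v) / 2) < (Φ u + Φ v) / 2) :
    StrictConvexOn ℝ Set.univ Φ := by
  have key : ∀ u v : ℝ, u ≠ v → ∀ a b : ℝ, 0 < a → a ≤ b → a + b = 1 →
      Φ (a * u + b * v) < a * Φ u + b * Φ v := by
    intro u v huv a b ha hab h
    have h1 := hΦ.2 (Set.mem_univ ((u + v) / 2)) (Set.mem_univ v)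
      (by linarith : 0 ≤ 2 * a) (by linarith : 0 ≤ b - a) (by linarith)
    simp only [smul_eq_mul] at h1
    rw [show 2 * a * ((u + v) / 2) + (b - a) * v = a * u + b * v by ring] at h1
    have h2 := mul_lt_mul_of_pos_left (hsc u v huv) (by linarith : 0 < 2 * a)
    linarith
  refine ⟨convex_univ, fun u _ v _ huv a b ha hb h => ?_⟩
  simp only [smul_eq_mul]
  rcases le_total a b with hab | hab
  · exact key u v huv a b ha hab h
  · have := key v u huv.symm b a hb hab (by linarith)
    rw [add_comm (a * u), add_comm (a * Φ u)]
    exact this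

theorem Iphi_congr_ae {Ω : Type*} [MeasurableSpace Ω] {μ : Measure Ω} (Φ : ℝ → ℝ)
    {x y : Ω → ℝ} (h : x =ᵐ[μ] y) : Iphi μ Φ x = Iphi μ Φ y :=
  lintegral_congr_ae (h.mono fun t ht => by simp only [ht])

theorem aTerm_abs_add_abs {Ω : Type*} [MeasurableSpace Ω] (μ : Measure Ω) (Φ : ℝ → ℝ)
    {x : Ω → ℝ} {k : ℝ} (h : Iphi μ Φ (fun t => k * x t) ≠ ⊤) :
    aTerm μ Φ (fun a => |a.1| + |a.2|) x k
      = ENNReal.ofReal ((1 + (Iphi μ Φ (fun t => k * x t)).toReal) / k) := by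
  rw [aTerm, if_neg h]
  simp only [abs_one, abs_of_nonneg ENNReal.toReal_nonneg]
  rw [one_div_mul_eq_div]

/-- The Amemiya norm vanishes on functions which are zero almost everywhere. -/
theorem aNorm_eq_zero_of_ae_eq_zero {Ω : Type*} [MeasurableSpace Ω] {μ : Measure Ω} {Φ : ℝ → ℝ}
    (h0 : Φ 0 = 0) {x : Ω → ℝ} (hx : x =ᵐ[μ] 0) :
    aNorm μ Φ (fun a => |a.1| + |a.2|) x = 0 := by
  have hI : ∀ k : ℝ, Iphi μ Φ (fun t => k * x t) = 0 := fun k => by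
    rw [Iphi_congr_ae Φ (y := fun _ => 0) (hx.mono fun t ht => by simp [ht])]
    simp [Iphi, h0]
  refine le_antisymm (le_of_forall_gt fun c hc => ?_) zero_le
  obtain ⟨r, hr, hrc⟩ := ENNReal.lt_iff_exists_nnreal_btwn.1 hc
  have hr' : (0 : ℝ) < r := by exact_mod_cast hr
  refine lt_of_le_of_lt (iInf₂_le (r : ℝ)⁻¹ (inv_pos.2 hr')) ?_
  rw [aTerm_abs_add_abs μ Φ (by simp [hI]), hI]
  simpa using hrc

/-- If the Amemiya norm of `x` is `1` and attained at `k`, then `1 + I_Φ(kx) = k`. -/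
theorem Iphi_of_aTerm_eq_one {Ω : Type*} [MeasurableSpace Ω] {μ : Measure Ω} {Φ : ℝ → ℝ}
    {x : Ω → ℝ} {k : ℝ} (hk : 0 < k) (h : aTerm μ Φ (fun a => |a.1| + |a.2|) x k = 1) :
    Iphi μ Φ (fun t => k * x t) ≠ ⊤ ∧ 1 + (Iphi μ Φ (fun t => k * x t)).toReal = k := by
  have hfin : Iphi μ Φ (fun t => k * x t) ≠ ⊤ := fun hI => by simp [aTerm, hI] at h
  refine ⟨hfin, ?_⟩
  rw [aTerm_abs_add_abs μ Φ hfin, ENNReal.ofReal_eq_one, div_eq_one_iff_eq hk.ne'] at h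
  exact h

/-- Strict convexity of the modular of a strictly convex Orlicz function. -/
theorem Iphi_convex_comb_lt {Ω : Type*} [MeasurableSpace Ω] {μ : Measure Ω} {Φ : ℝ → ℝ}
    (hΦ : StrictConvexOn ℝ Set.univ Φ) (hnn : ∀ u, 0 ≤ Φ u) {x y : Ω → ℝ}
    (hx : Measurable x) (hy : Measurable y) (hIx : Iphi μ Φ x ≠ ⊤) (hIy : Iphi μ Φ y ≠ ⊤)
    (hxy : ¬ x =ᵐ[μ] y) {a b : ℝ} (ha : 0 < a) (hb : 0 < b) (hab : a + b = 1) :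
    Iphi μ Φ (fun t => a * x t + b * y t)
      < ENNReal.ofReal a * Iphi μ Φ x + ENNReal.ofReal b * Iphi μ Φ y := by
  have hm : Measurable Φ :=
    (continuousOn_univ.1 (hΦ.convexOn.continuousOn isOpen_univ)).measurable
  have hmx : Measurable fun t => ENNReal.ofReal (Φ (x t)) := (hm.comp hx).ennreal_ofReal
  have hmy : Measurable fun t => ENNReal.ofReal (Φ (y t)) := (hm.comp hy).ennreal_ofReal
  have hpt : ∀ t, ENNReal.ofReal a * ENNReal.ofReal (Φ (x t))
      + ENNReal.ofReal b * ENNReal.ofReal (Φ (y t))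
      = ENNReal.ofReal (a * Φ (x t) + b * Φ (y t)) := fun t => by
    rw [ENNReal.ofReal_add (mul_nonneg ha.le (hnn _)) (mul_nonneg hb.le (hnn _)),
      ENNReal.ofReal_mul ha.le, ENNReal.ofReal_mul hb.le]
  have hsum : ENNReal.ofReal a * Iphi μ Φ x + ENNReal.ofReal b * Iphi μ Φ y
      = ∫⁻ t, ENNReal.ofReal (a * Φ (x t) + b * Φ (y t)) ∂μ := by
    simp only [Iphi, ← hpt]
    rw [lintegral_add_left (hmx.const_mul _), lintegral_const_mul _ hmx,
      lintegral_const_mul _ hmy]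
  have hle : ∀ t, ENNReal.ofReal (Φ (a * x t + b * y t))
      ≤ ENNReal.ofReal (a * Φ (x t) + b * Φ (y t)) := fun t =>
    ENNReal.ofReal_le_ofReal (hΦ.convexOn.2 trivial trivial ha.le hb.le hab)
  have hfin : ENNReal.ofReal a * Iphi μ Φ x + ENNReal.ofReal b * Iphi μ Φ y ≠ ⊤ := by
    finiteness
  rw [hsum] at hfin ⊢
  refine lintegral_strict_mono_of_ae_le_of_frequently_ae_lt
    (((hm.comp hx).const_mul a).add ((hm.comp hy).const_mul b)).ennreal_ofReal.aemeasurable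
    (ne_top_of_le_ne_top hfin (lintegral_mono hle)) (ae_of_all _ hle) ?_
  refine (not_eventually.1 hxy).mono fun t ht => ?_
  have hlt := hΦ.2 (Set.mem_univ (x t)) (Set.mem_univ (y t)) ht ha hb hab
  exact ((ENNReal.ofReal_lt_ofReal_iff_of_nonneg (hnn _)).2 hlt).ne

/-- If `Φ` is a strictly convex Orlicz function and the infimum defining the Orlicz (Amemiya)
norm `‖x‖⁰_Φ = inf_{k>0} (1/k)(1 + I_Φ(kx))` is attained for every nonzero `x ∈ L^Φ(μ)`,
then `(L^Φ(μ), ‖·‖⁰_Φ)` is strictly convex. Here `‖·‖⁰_Φ = ‖·‖_{Φ,p}` for the lattice norm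
`p (u,v) = |u| + |v|`. -/
theorem stmt7 {Ω : Type*} [MeasurableSpace Ω] (μ : Measure Ω) [SigmaFinite μ]
    (Φ : ℝ → ℝ) (hΦ : IsOrlicz Φ)
    (hsc : ∀ u v : ℝ, u ≠ v → Φ ((u + v) / 2) < (Φ u + Φ v) / 2)
    (hatt : ∀ x : Ω → ℝ, MemLphi μ Φ x → ¬ x =ᵐ[μ] 0 →
      ∃ k : ℝ, 0 < k ∧ aNorm μ Φ (fun a => |a.1| + |a.2|) x
        = aTerm μ Φ (fun a => |a.1| + |a.2|) x k)
    (x y : Ω → ℝ) (hx : MemLphi μ Φ x) (hy : MemLphi μ Φ y)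
    (hnx : aNorm μ Φ (fun a => |a.1| + |a.2|) x = 1)
    (hny : aNorm μ Φ (fun a => |a.1| + |a.2|) y = 1) (hxy : ¬ x =ᵐ[μ] y) :
    aNorm μ Φ (fun a => |a.1| + |a.2|) (fun t => (x t + y t) / 2) < 1 := by
  obtain ⟨hconv, -, h0, hnn, -⟩ := hΦ
  have hne : ∀ z : Ω → ℝ, aNorm μ Φ (fun a => |a.1| + |a.2|) z = 1 → ¬ z =ᵐ[μ] 0 :=
    fun z hz h => by simp [aNorm_eq_zero_of_ae_eq_zero h0 h] at hz
  obtain ⟨k, hk, hxk⟩ := hatt x hx (hne x hnx)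
  obtain ⟨l, hl, hyl⟩ := hatt y hy (hne y hny)
  obtain ⟨hIx, hIxk⟩ := Iphi_of_aTerm_eq_one hk (hxk.symm.trans hnx)
  obtain ⟨hIy, hIyl⟩ := Iphi_of_aTerm_eq_one hl (hyl.symm.trans hny)
  have hkl : ¬ (fun t => k * x t) =ᵐ[μ] fun t => l * y t := fun h => by
    have hI := Iphi_congr_ae Φ h
    have hkl : k = l := by rw [← hIxk, ← hIyl, hI]
    subst hkl
    exact hxy (h.mono fun t ht => mul_left_cancel₀ hk.ne' ht)
  have hkl0 : 0 < k + l := by positivity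
  have hlt := Iphi_convex_comb_lt (strictConvexOn_of_midpoint hconv hsc) hnn
    (hx.1.const_mul k) (hy.1.const_mul l) hIx hIy hkl
    (div_pos hl hkl0) (div_pos hk hkl0) (by field_simp; ring)
  set m : ℝ := 2 * k * l / (k + l) with hm
  have hm0 : 0 < m := by positivity
  have hfun : (fun t => l / (k + l) * (k * x t) + k / (k + l) * (l * y t))
      = fun t => m * ((x t + y t) / 2) := by
    funext t
    rw [hm]
    field_simp
  rw [hfun] at hlt
  have hlt' := (ENNReal.toReal_lt_toReal hlt.ne_top (by finiteness)).2 hlt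
  rw [ENNReal.toReal_add (by finiteness) (by finiteness), ENNReal.toReal_mul, ENNReal.toReal_mul,
    ENNReal.toReal_ofReal (by positivity), ENNReal.toReal_ofReal (by positivity),
    eq_sub_of_add_eq' hIxk, eq_sub_of_add_eq' hIyl] at hlt'
  have hrhs : l / (k + l) * (k - 1) + k / (k + l) * (l - 1) = m - 1 := by
    rw [hm]
    field_simp
    ring
  refine lt_of_le_of_lt (iInf₂_le m hm0) ?_
  rw [aTerm_abs_add_abs μ Φ hlt.ne_top, ENNReal.ofReal_lt_one, div_lt_one hm0]
  linarith
end
end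

section
/- Let p be a lattice norm on ℝ² with p((1,0)) = 1, and let Φ be an Orlicz function such that K(x) ≠ ∅ for every x ∈ E^Φ(μ) with x ≠ 0. Assume there exists a measurable set B with 0 < μ(B) < ∞ and μ(Ω \ B) > 0. If a(Φ) > 0, then (E^Φ(μ), ‖·‖_{Φ,p}) is not strictly monotone: there exist x, y ∈ E^Φ(μ) with 0 ≤ x ≤ y μ-a.e., x not μ-a.e. equal to y, and ‖x‖_{Φ,p} = ‖y‖_{Φ,p}. -/
open MeasureTheory Filter

noncomputable section

theorem IsOrlicz.le_of_le {Φ : ℝ → ℝ} (hΦ : IsOrlicz Φ) {u v : ℝ} (hu : 0 ≤ u) (huv : u ≤ v) :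
    Φ u ≤ Φ v := by
  obtain ⟨hc, he, -, -, -⟩ := hΦ
  have h := hc.le_max_of_mem_Icc (Set.mem_univ (-v)) (Set.mem_univ v)
    (z := u) ⟨by linarith, huv⟩
  simpa [he v] using h

theorem Iphi_mono {Ω : Type*} [MeasurableSpace Ω] (μ : Measure Ω) {Φ : ℝ → ℝ} (hΦ : IsOrlicz Φ)
    {x y : Ω → ℝ} (hx : ∀ t, 0 ≤ x t) (hxy : ∀ t, x t ≤ y t) : Iphi μ Φ x ≤ Iphi μ Φ y :=
  lintegral_mono fun t => ENNReal.ofReal_le_ofReal (hΦ.le_of_le (hx t) (hxy t))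

theorem aNorm_mono {Ω : Type*} [MeasurableSpace Ω] (μ : Measure Ω) {Φ : ℝ → ℝ} (hΦ : IsOrlicz Φ)
    {p : ℝ × ℝ → ℝ} (hp : IsLatticeNorm p) {x y : Ω → ℝ} (hx : ∀ t, 0 ≤ x t)
    (hxy : ∀ t, x t ≤ y t) : aNorm μ Φ p x ≤ aNorm μ Φ p y := by
  refine iInf_mono fun k => iInf_mono fun hk => ?_
  have hI : Iphi μ Φ (fun t => k * x t) ≤ Iphi μ Φ (fun t => k * y t) :=
    Iphi_mono μ hΦ (fun t => mul_nonneg hk.le (hx t))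
      (fun t => mul_le_mul_of_nonneg_left (hxy t) hk.le)
  unfold aTerm
  by_cases hy : Iphi μ Φ (fun t => k * y t) = ⊤
  · simp [hy]
  · rw [if_neg hy, if_neg (ne_top_of_le_ne_top hy hI)]
    refine ENNReal.ofReal_le_ofReal (mul_le_mul_of_nonneg_left ?_ (by positivity))
    refine hp.2.2.2 _ _ le_rfl ?_
    simpa using ENNReal.toReal_mono hy hI

/-- A bounded nonnegative measurable function supported on a set of finite measure lies
in `E^Φ(μ)`. -/
theorem memEphi_of_le_indicator {Ω : Type*} [MeasurableSpace Ω] {μ : Measure Ω} {Φ : ℝ → ℝ}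
    (hΦ : IsOrlicz Φ) {x : Ω → ℝ} (hm : Measurable x) {S : Set Ω} (hS : MeasurableSet S)
    (hSfin : μ S ≠ ⊤) {M : ℝ} (hx : ∀ t, 0 ≤ x t) (hxS : ∀ t, x t ≤ S.indicator (fun _ => M) t) :
    MemEphi μ Φ x := by
  refine ⟨hm, fun l hl => ?_⟩
  refine ne_top_of_le_ne_top ?_ (Iphi_mono μ hΦ (fun t => mul_nonneg hl.le (hx t))
      (fun t => mul_le_mul_of_nonneg_left (hxS t) hl.le))
  have h : ∀ t, ENNReal.ofReal (Φ (l * S.indicator (fun _ => M) t)) =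
      S.indicator (fun _ => ENNReal.ofReal (Φ (l * M))) t := by
    intro t
    by_cases ht : t ∈ S <;> simp [ht, hΦ.2.2.1]
  simp only [Iphi, h]
  rw [lintegral_indicator_const hS]
  exact ENNReal.mul_ne_top ENNReal.ofReal_ne_top hSfin

theorem exists_pos_eq_zero_of_aPhi_pos {Φ : ℝ → ℝ} (ha : 0 < aPhi Φ) : ∃ c, 0 < c ∧ Φ c = 0 := by
  by_contra! h
  refine ha.not_ge (Real.sSup_nonpos ?_)
  rintro u ⟨-, hu⟩
  by_contra! hpos
  exact h u hpos hu

/-- If `p` is a lattice norm on `ℝ²` with `p (1,0) = 1`, `Φ` is an Orlicz function with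
`K(x) ≠ ∅` for every nonzero `x ∈ E^Φ(μ)`, the space contains a measurable set `B` with
`0 < μ B < ∞` and `μ (Ω∖B) > 0`, and `a(Φ) > 0`, then `(E^Φ(μ), ‖·‖_{Φ,p})` is not strictly
monotone. -/
theorem stmt9 {Ω : Type*} [MeasurableSpace Ω] (μ : Measure Ω) [SigmaFinite μ]
    (Φ : ℝ → ℝ) (hΦ : IsOrlicz Φ)
    (p : ℝ × ℝ → ℝ) (hp : IsLatticeNorm p) (h10 : p (1, 0) = 1)
    (hK : ∀ x : Ω → ℝ, MemEphi μ Φ x → ¬ x =ᵐ[μ] 0 → (Kset μ Φ p x).Nonempty)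
    (B : Set Ω) (hB : MeasurableSet B) (hB0 : 0 < μ B) (hBfin : μ B < ⊤)
    (hBc : 0 < μ Bᶜ)
    (ha : 0 < aPhi Φ) :
    ∃ x y : Ω → ℝ, MemEphi μ Φ x ∧ MemEphi μ Φ y ∧
      (∀ᵐ t ∂μ, 0 ≤ x t ∧ x t ≤ y t) ∧ ¬ x =ᵐ[μ] y ∧
      aNorm μ Φ p x = aNorm μ Φ p y := by
  obtain ⟨c, hc, hΦc⟩ := exists_pos_eq_zero_of_aPhi_pos ha
  obtain ⟨A, hA, hAB, hA0, hAfin⟩ :=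
    Measure.exists_subset_measure_lt_top hB.compl hBc
  set x : Ω → ℝ := B.indicator (fun _ => 1) with hx_def
  have hx0 : ∀ t, 0 ≤ x t := fun t => Set.indicator_nonneg (fun _ _ => zero_le_one) t
  have hxm : Measurable x := measurable_const.indicator hB
  have hxE : MemEphi μ Φ x :=
    memEphi_of_le_indicator hΦ hxm hB hBfin.ne hx0 (fun _ => le_rfl)
  have hxne : ¬ x =ᵐ[μ] 0 := by
    intro h
    refine hB0.ne' (measure_mono_null (fun t ht => ?_) (ae_iff.1 h))
    simp [hx_def, ht]
  obtain ⟨k, hk, hxk⟩ := hK x hxE hxne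
  have hd : 0 < c / k := div_pos hc hk
  set z : Ω → ℝ := A.indicator (fun _ => c / k) with hz_def
  have hz0 : ∀ t, 0 ≤ z t := fun t => Set.indicator_nonneg (fun _ _ => hd.le) t
  have hzA : ∀ t ∈ A, z t = c / k := fun t ht => by simp [hz_def, ht]
  have hxA : ∀ t ∈ A, x t = 0 := fun t ht => Set.indicator_of_notMem (hAB ht) _
  have hxy : ∀ t, x t ≤ (x + z) t := fun t => le_add_of_nonneg_right (hz0 t)
  have hI : Iphi μ Φ (fun t => k * (x + z) t) = Iphi μ Φ (fun t => k * x t) := by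
    refine lintegral_congr fun t => ?_
    by_cases ht : t ∈ A
    · simp [hxA t ht, hzA t ht, mul_div_cancel₀ c hk.ne', hΦc, hΦ.2.2.1]
    · simp [hz_def, ht]
  refine ⟨x, x + z, hxE, ?_, .of_forall fun t => ⟨hx0 t, hxy t⟩, ?_, ?_⟩
  · refine memEphi_of_le_indicator (M := 1 + c / k) hΦ (hxm.add (measurable_const.indicator hA))
      (hB.union hA) (measure_union_lt_top hBfin hAfin).ne (fun t => add_nonneg (hx0 t) (hz0 t)) ?_
    intro t
    by_cases htA : t ∈ A
    · simp [hxA t htA, hzA t htA, htA]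
    · by_cases htB : t ∈ B <;> simp [hx_def, hz_def, htA, htB, hd.le]
  · intro h
    refine hA0.ne' (measure_mono_null (fun t ht => ?_) (ae_iff.1 h))
    simp [hzA t ht, hc.ne', hk.ne']
  · refine le_antisymm (aNorm_mono μ hΦ hp hx0 hxy) ?_
    rw [hxk]
    refine (iInf₂_le k hk).trans_eq ?_
    rw [aTerm, aTerm, hI]
end
end

section
/- Let p be a strictly monotone lattice norm on ℝ² with p((1,0)) = p((0,1)) = 1, and let Φ be an Orlicz function with a(Φ) = 0. Then (L^Φ(μ), ‖·‖_{Φ,p}) is strictly monotone: for all x, y ∈ L^Φ(μ) with 0 ≤ x ≤ y μ-a.e. and x not μ-a.e. equal to y, one has ‖x‖_{Φ,p} < ‖y‖_{Φ,p}. -/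
open MeasureTheory Filter

noncomputable section

namespace IsOrlicz

variable {Φ : ℝ → ℝ}

lemma continuous_s11 (hΦ : IsOrlicz Φ) : Continuous Φ := by
  rw [← continuousOn_univ]
  exact hΦ.1.continuousOn isOpen_univ

lemma map_mul_le_s11 (hΦ : IsOrlicz Φ) {c : ℝ} (hc : 0 ≤ c) (hc1 : c ≤ 1) (u : ℝ) :
    Φ (c * u) ≤ c * Φ u := by
  have h := hΦ.1.2 (Set.mem_univ u) (Set.mem_univ 0) hc (sub_nonneg.2 hc1) (by ring)
  simpa [hΦ.2.2.1] using h

lemma map_add_map_le (hΦ : IsOrlicz Φ) {u v : ℝ} (hu : 0 ≤ u) (hv : 0 ≤ v) :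
    Φ u + Φ v ≤ Φ (u + v) := by
  rcases (add_nonneg hu hv).eq_or_lt with h | h
  · obtain rfl : u = 0 := by linarith
    obtain rfl : v = 0 := by linarith
    simp [hΦ.2.2.1]
  · have h1 := hΦ.map_mul_le_s11 (div_nonneg hu h.le) ((div_le_one h).2 (by linarith)) (u + v)
    have h2 := hΦ.map_mul_le_s11 (div_nonneg hv h.le) ((div_le_one h).2 (by linarith)) (u + v)
    rw [div_mul_cancel₀ _ h.ne'] at h1 h2
    have h3 : u / (u + v) * Φ (u + v) + v / (u + v) * Φ (u + v) = Φ (u + v) := by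
      field_simp
    linarith

lemma monotoneOn (hΦ : IsOrlicz Φ) : MonotoneOn Φ (Set.Ici 0) := by
  intro u hu v _ huv
  have h := hΦ.map_add_map_le hu (sub_nonneg.2 huv)
  rw [add_sub_cancel] at h
  linarith [hΦ.2.2.2.1 (v - u)]

lemma pos (hΦ : IsOrlicz Φ) (ha : aPhi Φ = 0) {u : ℝ} (hu : 0 < u) : 0 < Φ u := by
  refine (hΦ.2.2.2.1 u).lt_of_ne' fun h0 => ?_
  obtain ⟨w, hw⟩ := hΦ.2.2.2.2
  have hw' : Φ |w| ≠ 0 := by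
    rcases abs_choice w with h | h <;> simp [h, hΦ.2.1, hw]
  have hbdd : BddAbove {u : ℝ | 0 ≤ u ∧ Φ u = 0} := by
    refine ⟨|w|, fun v hv => ?_⟩
    by_contra! hlt
    have := hΦ.monotoneOn (Set.mem_Ici.2 (abs_nonneg w)) (Set.mem_Ici.2 hv.1) hlt.le
    exact hw' (le_antisymm (this.trans hv.2.le) (hΦ.2.2.2.1 _))
  have : u ≤ aPhi Φ := le_csSup hbdd ⟨hu.le, h0⟩
  linarith

variable {Ω : Type*} [MeasurableSpace Ω] {μ : Measure Ω}

lemma Iphi_mul_le_s11 (hΦ : IsOrlicz Φ) {c k : ℝ} (hc : 0 < c) (hck : c ≤ k) (z : Ω → ℝ) :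
    Iphi μ Φ (fun t => c * z t) ≤ ENNReal.ofReal (c / k) * Iphi μ Φ (fun t => k * z t) := by
  have hk : 0 < k := hc.trans_le hck
  have hr : 0 ≤ c / k := (div_pos hc hk).le
  unfold Iphi
  rw [← lintegral_const_mul' _ _ ENNReal.ofReal_ne_top]
  refine lintegral_mono fun t => ?_
  rw [← ENNReal.ofReal_mul hr]
  refine ENNReal.ofReal_le_ofReal ?_
  have h := hΦ.map_mul_le_s11 hr ((div_le_one hk).2 hck) (k * z t)
  rwa [← mul_assoc, div_mul_cancel₀ _ hk.ne'] at h

lemma Iphi_add_Iphi_sub_le (hΦ : IsOrlicz Φ) {x y : Ω → ℝ} (hx : Measurable x)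
    (hle : ∀ᵐ t ∂μ, 0 ≤ x t ∧ x t ≤ y t) {k : ℝ} (hk : 0 ≤ k) :
    Iphi μ Φ (fun t => k * x t) + Iphi μ Φ (fun t => k * (y t - x t)) ≤
      Iphi μ Φ (fun t => k * y t) := by
  have hm : Measurable fun t => ENNReal.ofReal (Φ (k * x t)) :=
    (hΦ.continuous_s11.measurable.comp (hx.const_mul k)).ennreal_ofReal
  unfold Iphi
  rw [← lintegral_add_left hm]
  refine lintegral_mono_ae ?_
  filter_upwards [hle] with t ht
  rw [← ENNReal.ofReal_add (hΦ.2.2.2.1 _) (hΦ.2.2.2.1 _)]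
  refine ENNReal.ofReal_le_ofReal ?_
  have h := hΦ.map_add_map_le (mul_nonneg hk ht.1) (mul_nonneg hk (sub_nonneg.2 ht.2))
  rwa [← mul_add, add_sub_cancel] at h

lemma Iphi_sub_ne_zero (hΦ : IsOrlicz Φ) (ha : aPhi Φ = 0) {x y : Ω → ℝ} (hx : Measurable x)
    (hy : Measurable y) (hle : ∀ᵐ t ∂μ, x t ≤ y t) (hne : ¬ x =ᵐ[μ] y) {k : ℝ} (hk : 0 < k) :
    Iphi μ Φ (fun t => k * (y t - x t)) ≠ 0 := by
  have hm : Measurable fun t => ENNReal.ofReal (Φ (k * (y t - x t))) :=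
    (hΦ.continuous_s11.measurable.comp ((hy.sub hx).const_mul k)).ennreal_ofReal
  unfold Iphi
  intro h
  rw [lintegral_eq_zero_iff hm] at h
  refine hne ?_
  filter_upwards [h, hle] with t ht hxy
  refine le_antisymm hxy (not_lt.1 fun hlt => ?_)
  have := hΦ.pos ha (mul_pos hk (sub_pos.2 hlt))
  simp only [Pi.zero_apply, ENNReal.ofReal_eq_zero] at ht
  linarith

end IsOrlicz

namespace IsLatticeNorm

variable {p : ℝ × ℝ → ℝ}

lemma continuous_s11 (hp : IsLatticeNorm p) : Continuous p := by
  have hconv : ConvexOn ℝ Set.univ p := by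
    refine ⟨convex_univ, fun a _ b _ s t hs ht _ => ?_⟩
    have h := hp.1 (s • a) (t • b)
    rwa [hp.2.1, hp.2.1, abs_of_nonneg hs, abs_of_nonneg ht] at h
  rw [← continuousOn_univ]
  exact hconv.continuousOn isOpen_univ

lemma nonneg_s11 (hp : IsLatticeNorm p) (a : ℝ × ℝ) : 0 ≤ p a := by
  have h0 : p 0 = 0 := by simpa using hp.2.1 0 0
  rw [← h0]
  exact hp.2.2.2 0 a (by simp) (by simp)

lemma fst_le (hp : IsLatticeNorm p) (h10 : p (1, 0) = 1) {a b : ℝ} (ha : 0 ≤ a) :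
    a ≤ p (a, b) := by
  have h := hp.2.1 a (1, 0)
  rw [h10, abs_of_nonneg ha, mul_one] at h
  exact h.symm.trans_le (hp.2.2.2 _ _ (by simp) (by simp))

lemma snd_le (hp : IsLatticeNorm p) (h01 : p (0, 1) = 1) {a b : ℝ} (hb : 0 ≤ b) :
    b ≤ p (a, b) := by
  have h := hp.2.1 b (0, 1)
  rw [h01, abs_of_nonneg hb, mul_one] at h
  exact h.symm.trans_le (hp.2.2.2 _ _ (by simp) (by simp))

/-- On bounded sets, lowering the second coordinate by `δ` lowers the norm by a uniform amount. -/
lemma exists_gap (hp : IsLatticeNorm p) (hpm : StrictMonoNorm p) {δ : ℝ} (hδ : 0 < δ) (M : ℝ) :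
    ∃ η > 0, ∀ a b : ℝ, 0 ≤ a → a ≤ M → δ ≤ b → b ≤ M → p (a, b - δ) + η ≤ p (a, b) := by
  have hcont : Continuous fun q : ℝ × ℝ => p q - p (q.1, q.2 - δ) :=
    hp.continuous_s11.sub (hp.continuous_s11.comp (by fun_prop))
  obtain ⟨η, hη, h⟩ := (isCompact_Icc (a := ((0, δ) : ℝ × ℝ)) (b := (M, M))).exists_forall_le'
    hcont.continuousOn (a := 0) fun q hq => sub_pos.2 <| by
      obtain ⟨⟨h1, h2⟩, -⟩ := hq
      exact hpm _ _ h1 (sub_nonneg.2 h2) le_rfl (by simp [hδ.le])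
        fun h => by have := congrArg Prod.snd h; simp at this; linarith
  refine ⟨η, hη, fun a b ha haM hb hbM => ?_⟩
  have := h (a, b) ⟨⟨ha, hb⟩, ⟨haM, hbM⟩⟩
  dsimp only at this
  linarith

/-- Outside the infinite case, `aTerm` is the norm of the rescaled pair. -/
lemma aTerm_eq (hp : IsLatticeNorm p) {Ω : Type*} [MeasurableSpace Ω] {μ : Measure Ω}
    {Φ : ℝ → ℝ} {x : Ω → ℝ} {k : ℝ} (hk : 0 < k) (h : Iphi μ Φ (fun t => k * x t) ≠ ⊤) :
    aTerm μ Φ p x k =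
      ENNReal.ofReal (p (1 / k, (Iphi μ Φ (fun t => k * x t)).toReal / k)) := by
  rw [aTerm, if_neg h]
  have := hp.2.1 (1 / k) (1, (Iphi μ Φ (fun t => k * x t)).toReal)
  rw [abs_of_pos (one_div_pos.2 hk)] at this
  rw [← this, Prod.smul_mk, smul_eq_mul, smul_eq_mul, mul_one, one_div_mul_eq_div]

end IsLatticeNorm

/-- If `p` is a strictly monotone lattice norm on `ℝ²` with `p (1,0) = p (0,1) = 1` and `Φ` is
an Orlicz function with `a(Φ) = 0`, then `(L^Φ(μ), ‖·‖_{Φ,p})` is strictly monotone. -/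
theorem stmt11 {Ω : Type*} [MeasurableSpace Ω] (μ : Measure Ω) [SigmaFinite μ]
    (Φ : ℝ → ℝ) (hΦ : IsOrlicz Φ) (ha : aPhi Φ = 0)
    (p : ℝ × ℝ → ℝ) (hp : IsLatticeNorm p) (hpm : StrictMonoNorm p)
    (h10 : p (1, 0) = 1) (h01 : p (0, 1) = 1)
    (x y : Ω → ℝ) (hx : MemLphi μ Φ x) (hy : MemLphi μ Φ y)
    (hle : ∀ᵐ t ∂μ, 0 ≤ x t ∧ x t ≤ y t) (hne : ¬ x =ᵐ[μ] y) :
    aNorm μ Φ p x < aNorm μ Φ p y := by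
  obtain ⟨hxm, -⟩ := hx
  obtain ⟨hym, l, hl, hly⟩ := hy
  have hN : aNorm μ Φ p y ≠ ⊤ := by
    refine ne_top_of_le_ne_top ?_ (iInf₂_le l hl)
    rw [hp.aTerm_eq hl hly]
    exact ENNReal.ofReal_ne_top
  obtain ⟨N, hN0, hNy⟩ : ∃ N : ℝ, 0 ≤ N ∧ aNorm μ Φ p y = ENNReal.ofReal N :=
    ⟨_, ENNReal.toReal_nonneg, (ENNReal.ofReal_toReal hN).symm⟩
  obtain ⟨c, hc, hcN, hcl⟩ : ∃ c : ℝ, 0 < c ∧ c ≤ 1 / (N + 1) ∧ c ≤ l :=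
    ⟨min (1 / (N + 1)) l, lt_min (by positivity) hl, min_le_left _ _, min_le_right _ _⟩
  have hadd {k : ℝ} (hk : 0 < k) := hΦ.Iphi_add_Iphi_sub_le hxm hle hk.le
  have hlz : Iphi μ Φ (fun t => l * (y t - x t)) ≠ ⊤ :=
    ne_top_of_le_ne_top hly (le_add_self.trans (hadd hl))
  have hcz : Iphi μ Φ (fun t => c * (y t - x t)) ≠ ⊤ :=
    ne_top_of_le_ne_top (ENNReal.mul_ne_top ENNReal.ofReal_ne_top hlz)
      (hΦ.Iphi_mul_le_s11 hc hcl _)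
  have hcz0 := hΦ.Iphi_sub_ne_zero ha hxm hym (hle.mono fun t ht => ht.2) hne hc
  set δ : ℝ := (Iphi μ Φ (fun t => c * (y t - x t))).toReal / c with hδdef
  have hδ : 0 < δ := div_pos (ENNReal.toReal_pos hcz0 hcz) hc
  obtain ⟨η, hη, hgap⟩ := hp.exists_gap hpm hδ (N + 1)
  have hlt : aNorm μ Φ p y < ENNReal.ofReal (N + min η 1) := by
    rw [hNy]
    exact (ENNReal.ofReal_lt_ofReal_iff (by positivity)).2 (by simp [hη])
  obtain ⟨k, hk, hky⟩ := by simpa only [aNorm, iInf_lt_iff, exists_prop] using hlt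
  have hIy : Iphi μ Φ (fun t => k * y t) ≠ ⊤ := fun h => by simp [aTerm, h] at hky
  have hIx : Iphi μ Φ (fun t => k * x t) ≠ ⊤ :=
    ne_top_of_le_ne_top hIy (le_self_add.trans (hadd hk))
  have hIz : Iphi μ Φ (fun t => k * (y t - x t)) ≠ ⊤ :=
    ne_top_of_le_ne_top hIy (le_add_self.trans (hadd hk))
  rw [hp.aTerm_eq hk hIy, ENNReal.ofReal_lt_ofReal_iff (by positivity)] at hky
  have hxyz := ENNReal.toReal_mono hIy (hadd hk)
  rw [ENNReal.toReal_add hIx hIz] at hxyz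
  have hk0 : 0 ≤ 1 / k := by positivity
  have hkM : 1 / k ≤ N + 1 := by
    linarith [hp.fst_le h10 (b := (Iphi μ Φ (fun t => k * y t)).toReal / k) hk0, min_le_right η 1]
  have hyM : (Iphi μ Φ (fun t => k * y t)).toReal / k ≤ N + 1 := by
    linarith [hp.snd_le h01 (a := 1 / k) (b := (Iphi μ Φ (fun t => k * y t)).toReal / k)
      (by positivity), min_le_right η 1]
  have hck : c ≤ k := hcN.trans ((one_div_le hk (by positivity)).1 hkM)
  have hδk : δ ≤ (Iphi μ Φ (fun t => k * (y t - x t))).toReal / k := by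
    have h := ENNReal.toReal_mono (ENNReal.mul_ne_top ENNReal.ofReal_ne_top hIz)
      (hΦ.Iphi_mul_le_s11 hc hck (fun t => y t - x t))
    rw [ENNReal.toReal_mul, ENNReal.toReal_ofReal (by positivity)] at h
    rw [hδdef, div_le_iff₀ hc]
    exact h.trans_eq (by ring)
  have hsum : (Iphi μ Φ (fun t => k * x t)).toReal / k + δ ≤
      (Iphi μ Φ (fun t => k * y t)).toReal / k := by
    have := div_le_div_of_nonneg_right hxyz hk.le
    rw [add_div] at this
    linarith
  have hx0 : 0 ≤ (Iphi μ Φ (fun t => k * x t)).toReal / k := by positivity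
  have hmono : p (1 / k, (Iphi μ Φ (fun t => k * x t)).toReal / k) ≤
      p (1 / k, (Iphi μ Φ (fun t => k * y t)).toReal / k - δ) :=
    hp.2.2.2 _ _ le_rfl (abs_le_abs_of_nonneg hx0 (by linarith))
  have hg := hgap _ _ hk0 hkM (by linarith) hyM
  refine (iInf₂_le k hk).trans_lt ?_
  rw [hp.aTerm_eq hk hIx, hNy, ENNReal.ofReal_lt_ofReal_iff_of_nonneg (hp.nonneg_s11 _)]
  linarith [min_le_left η 1]
end
end
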